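/- Let p ≥ 2, A ∈ ℝ^{p×p}, and b ∈ ℝ^p. Then there exists a function ψ : ℝ^p → ℝ^p admitting a tensor-train representation with affine factors and ranks at most (p, p, …, p, 1) — i.e., there exist matrix-valued functions V₁ : ℝ → ℝ^{p×r₁}, Vₖ : ℝ → ℝ^{rₖ₋₁×rₖ} for 2 ≤ k ≤ p−1, V_p : ℝ → ℝ^{r_{p−1}×1}, with all rₖ ≤ p and all entries affine functions, such that ψ(h) = V₁(h₁)⋯V_p(h_p) — and such that h + ψ(h) = A h + b for all h ∈ ℝ^p. That is, any affine transformation of ℝ^p can be represented by a single compositional-tensor-train layer Id + ψ with TT rank at most p. -/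

import Mathlib

noncomputable def ttProdAux {d : ℕ} (r : Fin (d + 1) → ℕ)
    (U : ∀ i : Fin d, Matrix (Fin (r i.castSucc)) (Fin (r i.succ)) ℝ) :
    ∀ k : Fin (d + 1), Matrix (Fin (r 0)) (Fin (r k)) ℝ :=
  Fin.induction (motive := fun k => Matrix (Fin (r 0)) (Fin (r k)) ℝ) 1
    fun i acc => acc * U i

noncomputable def ttProd {d : ℕ} (r : Fin (d + 1) → ℕ)
    (U : ∀ i : Fin d, Matrix (Fin (r i.castSucc)) (Fin (r i.succ)) ℝ) :
    Matrix (Fin (r 0)) (Fin (r (Fin.last d))) ℝ :=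
  ttProdAux r U (Fin.last d)

def AffineEntry (f : ℝ → ℝ) : Prop := ∃ a b : ℝ, ∀ t, f t = a * t + b

def AffineFactor {m n : ℕ} (U : ℝ → Matrix (Fin m) (Fin n) ℝ) : Prop :=
  ∀ i j, AffineEntry fun t => U t i j

/-- The ranks `(p, …, p, 1)`. -/
def affineRank (p k : ℕ) : ℕ := if k = p then 1 else p

/-- Entries of the cores representing `h ↦ M h + β`: column `0` of the partial products
accumulates the value, and column `j ≥ 1` carries the `j`-th column of `M`. -/
noncomputable def affineCore (M : ℕ → ℕ → ℝ) (β : ℕ → ℝ) (k : ℕ) (t : ℝ) (i j : ℕ) : ℝ :=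
  if k = 0 then (if j = 0 then β i + M i 0 * t else M i j)
  else (if i = j then 1 else 0) + (if j = 0 ∧ i = k then t else 0)

theorem affineEntry_affineCore (M : ℕ → ℕ → ℝ) (β : ℕ → ℝ) (k i j : ℕ) :
    AffineEntry fun t => affineCore M β k t i j := by
  unfold affineCore
  split_ifs
  · exact ⟨M i 0, β i, fun t => by ring⟩
  · exact ⟨0, M i j, fun t => by ring⟩
  · exact ⟨1, 1, fun t => by ring⟩
  · exact ⟨0, 1, fun t => by ring⟩
  · exact ⟨1, 0, fun t => by ring⟩
  · exact ⟨0, 0, fun t => by ring⟩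

theorem ttProdAux_succ {d : ℕ} (r : Fin (d + 1) → ℕ)
    (U : ∀ i : Fin d, Matrix (Fin (r i.castSucc)) (Fin (r i.succ)) ℝ) (k : Fin d) :
    ttProdAux r U k.succ = ttProdAux r U k.castSucc * U k :=
  rfl

theorem affineRank_zero {p : ℕ} (hp : p ≠ 0) : affineRank p ((0 : Fin (p + 1)) : ℕ) = p :=
  if_neg (by simpa using hp.symm)

theorem ttProdAux_affineCore {p : ℕ} (M : ℕ → ℕ → ℝ) (β H : ℕ → ℝ) (k : Fin (p + 1)) :
    ∀ i j, ttProdAux (fun k : Fin (p + 1) => affineRank p k)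
      (fun k => Matrix.of fun i j => affineCore M β k (H k) i j) k i j =
      if (k : ℕ) = 0 then (if (i : ℕ) = j then 1 else 0)
      else if (j : ℕ) = 0 then β i + ∑ l ∈ Finset.range k, M i l * H l else M i j := by
  induction k using Fin.induction with
  | zero =>
    intro i j
    change (1 : Matrix (Fin (affineRank p _)) (Fin (affineRank p _)) ℝ) i j = _
    rw [Matrix.one_apply, if_pos (Fin.val_zero _)]
    exact if_congr Fin.ext_iff rfl rfl
  | succ k ih =>
    intro i j
    have hk : (k : ℕ) < p := k.isLt
    have hr : affineRank p (k.castSucc : ℕ) = p := if_neg (by simp; omega)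
    have hi : (i : ℕ) < p := i.isLt.trans_eq (affineRank_zero (by omega))
    have hj : (j : ℕ) < p := by
      have := j.isLt
      simp only [affineRank] at this
      split_ifs at this <;> omega
    rw [ttProdAux_succ, Matrix.mul_apply]
    simp only [ih, Matrix.of_apply]
    rw [Fin.sum_univ_eq_sum_range (fun x => (if (k.castSucc : ℕ) = 0 then
      (if (i : ℕ) = x then (1 : ℝ) else 0) else if x = 0 then
        β i + ∑ l ∈ Finset.range (k.castSucc : ℕ), M i l * H l else M i x) *
        affineCore M β k (H k) x j), hr]
    simp only [Fin.val_castSucc, Fin.val_succ, Nat.succ_ne_zero, if_false, affineCore]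
    by_cases h0 : (k : ℕ) = 0
    · simp [h0, hi]
    · by_cases hj0 : (j : ℕ) = 0
      · simp [h0, hj0, mul_add, Finset.sum_add_distrib, hk, k.pos,
          Finset.sum_range_succ]
        ring
      · simp [h0, hj0, hj]

/-- Any affine transformation h ↦ Ah + b of ℝ^p can be represented by a
single CTT layer Id + ψ, where ψ has a TT representation with affine factors and
ranks at most (p, p, …, p, 1). -/
theorem stmt_5 (p : ℕ) (hp : 2 ≤ p)
    (A : Matrix (Fin p) (Fin p) ℝ) (b : Fin p → ℝ) :
    ∃ (ψ : (Fin p → ℝ) → Fin p → ℝ) (r : Fin (p + 1) → ℕ) (h0 : r 0 = p),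
      r (Fin.last p) = 1 ∧
      (∀ k : Fin (p + 1), r k ≤ p) ∧
      ∃ U : ∀ i : Fin p, ℝ → Matrix (Fin (r i.castSucc)) (Fin (r i.succ)) ℝ,
        (∀ i, AffineFactor (U i)) ∧
        (∀ h : Fin p → ℝ, ∀ (i : Fin (r 0)) (j : Fin (r (Fin.last p))),
          ttProd r (fun k => U k (h k)) i j = ψ h (Fin.cast h0 i)) ∧
        (∀ h : Fin p → ℝ, h + ψ h = A.mulVec h + b) := by
  let M : ℕ → ℕ → ℝ := fun i j =>
    if h : i < p ∧ j < p then (A - 1) ⟨i, h.1⟩ ⟨j, h.2⟩ else 0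
  let β : ℕ → ℝ := fun i => if h : i < p then b ⟨i, h⟩ else 0
  refine ⟨fun h => (A - 1).mulVec h + b, fun k => affineRank p k, affineRank_zero (by omega),
    if_pos (by simp), fun k => ?_, fun k t => Matrix.of fun i j => affineCore M β k t i j,
    fun k i j => affineEntry_affineCore M β k i j, fun h i j => ?_, fun h => ?_⟩
  · simp only [affineRank]
    split_ifs <;> omega
  · let H : ℕ → ℝ := fun l => if hl : l < p then h ⟨l, hl⟩ else 0
    have hH : ∀ k : Fin p, h k = H k := fun k => by simp [H]
    have hj : (j : ℕ) = 0 := by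
      have := j.isLt
      simp only [affineRank, Fin.val_last, if_true] at this
      omega
    have hp0 : p ≠ 0 := by omega
    have hi : (i : ℕ) < p := i.isLt.trans_eq (affineRank_zero hp0)
    simp only [ttProd, hH]
    rw [ttProdAux_affineCore M β H]
    simp only [Fin.val_last, hp0, hj, if_false, if_true, Pi.add_apply, Matrix.mulVec, dotProduct,
      Finset.sum_range]
    rw [add_comm]
    congr 1
    · exact Finset.sum_congr rfl fun l _ => by simp only [M, hi, Fin.is_lt, and_self, dite_true, hH]; rfl
    · simp [β, hi]; rfl
  · simp only [Matrix.sub_mulVec, Matrix.one_mulVec]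
    abel
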